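/- If 𝔤 is not of type A₁ or A₂ (i.e., 𝔤 ≠ 𝔰𝔩(2), 𝔰𝔩(3)), then in Out(𝔫) = Der(𝔫)/ad(𝔫) the classes of the derivations Dᵢ, Bᵢ satisfy: [Dᵢ, Dⱼ] = 0 and [Bᵢ, Bⱼ] = 0 for all i, j, and [Dᵢ, Bⱼ] = wᵢ(bⱼ)·Bⱼ, where wᵢ(bⱼ) = Aᵢ(γⱼ) − δᵢⱼ is the i-th coordinate of the weight γⱼ − αⱼ of bⱼ. -/

import Mathlib

open scoped InnerProductSpace

attribute [local instance 100] LieRing.ofAssociativeRing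

/-- The combinatorial data attached to a simple finite-dimensional complex Lie algebra `𝔤`
of rank `n` with a fixed Cartan subalgebra and a fixed system of simple roots
`α₁, …, αₙ`: a reduced crystallographic *irreducible* root system `R` in a euclidean
space `V`, together with a base `simple : Fin n → V` (the simple roots) and the coordinate
functions `coord`, recording for each positive root `α = Σᵢ Aᵢ(α) αᵢ` the tuple
`(A₁(α), …, Aₙ(α))` of its coordinates with respect to the simple roots. -/
structure RootSystemBase (n : ℕ) (V : Type*) [NormedAddCommGroup V]
    [InnerProductSpace ℝ V] : Type _ where
  /-- The (finite) set of roots. -/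
  R : Finset V
  zero_not_mem : (0 : V) ∉ R
  span_eq_top : Submodule.span ℝ (R : Set V) = ⊤
  reduced : ∀ α ∈ R, ∀ c : ℝ, c • α ∈ R → c = 1 ∨ c = -1
  crystallographic : ∀ α ∈ R, ∀ β ∈ R, ∃ k : ℤ, (k : ℝ) = 2 * ⟪β, α⟫_ℝ / ⟪α, α⟫_ℝ
  reflect_mem : ∀ α ∈ R, ∀ β ∈ R, β - (2 * ⟪β, α⟫_ℝ / ⟪α, α⟫_ℝ) • α ∈ R
  /-- irreducibility: `R` is not the union of two nonempty orthogonal subsets;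
  equivalently `𝔤` is simple rather than merely semisimple. -/
  irreducible : ∀ S : Finset V, S ⊆ R → (∀ α ∈ S, ∀ β ∈ R, β ∉ S → ⟪α, β⟫_ℝ = 0) →
    S = ∅ ∨ S = R
  /-- The simple roots `α₁, …, αₙ`. -/
  simple : Fin n → V
  simple_mem : ∀ i, simple i ∈ R
  simple_linearIndependent : LinearIndependent ℝ simple
  /-- `coord β i` is the coefficient `Aᵢ(β)` of `β` in the basis of simple roots. -/
  coord : V → Fin n → ℤ
  root_eq_sum : ∀ β ∈ R, β = ∑ i, (coord β i : ℝ) • simple i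
  coord_sign : ∀ β ∈ R, (∀ i, 0 ≤ coord β i) ∨ (∀ i, coord β i ≤ 0)

namespace RootSystemBase

variable {n : ℕ} {V : Type*} [NormedAddCommGroup V] [InnerProductSpace ℝ V]
variable (Φ : RootSystemBase n V)

/-- `β` is a positive root. -/
def IsPos (β : V) : Prop := β ∈ Φ.R ∧ ∀ i, 0 ≤ Φ.coord β i

/-- The level `l(β) = Σᵢ Aᵢ(β)` of a root `β`. -/
def level (β : V) : ℤ := ∑ i, Φ.coord β i

/-- `μ` is the highest root. -/
def IsHighest (μ : V) : Prop :=
  Φ.IsPos μ ∧ ∀ β, Φ.IsPos β → ∀ i, Φ.coord β i ≤ Φ.coord μ i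

end RootSystemBase

/-- A linear map `T : 𝔫 → 𝔫` is a derivation of the Lie algebra `𝔫`. -/
def IsLieDerivation {L : Type*} [LieRing L] [LieAlgebra ℂ L] (T : Module.End ℂ L) : Prop :=
  ∀ x y : L, T ⁅x, y⁆ = ⁅T x, y⁆ + ⁅x, T y⁆

/-- The inner derivations `ad x`, `x ∈ 𝔫`, as a subspace of `End(𝔫)`. -/
noncomputable def innerDerivations (L : Type*) [LieRing L] [LieAlgebra ℂ L] :
    Submodule ℂ (Module.End ℂ L) :=
  LinearMap.range (LieAlgebra.ad ℂ L).toLinearMap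

/-- The derivations of `𝔫`, as a subspace of `End(𝔫)`. -/
noncomputable def derivations (L : Type*) [LieRing L] [LieAlgebra ℂ L] :
    Submodule ℂ (Module.End ℂ L) where
  carrier := {T | IsLieDerivation T}
  add_mem' := by
    intro S T hS hT x y
    simp only [LinearMap.add_apply, hS x y, hT x y, add_lie, lie_add]
    abel
  zero_mem' := by intro x y; simp
  smul_mem' := by
    intro c T hT x y
    simp only [LinearMap.smul_apply, hT x y, smul_lie, lie_smul, smul_add]

/-- A Chevalley-basis presentation of the maximal nilpotent subalgebra
`𝔫 = ⊕_{α ∈ R⁺} 𝔤_α` of a simple finite-dimensional complex Lie algebra `𝔤` with root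
system `Φ`: a complex Lie algebra `𝔫` together with a basis `e` of root vectors indexed
by the positive roots, such that `⁅e_α, e_β⁆ = N_{αβ} • e_{α+β}` when `α+β ∈ R⁺` and
`⁅e_α, e_β⁆ = 0` otherwise, where the structure constants `N_{αβ}` of the Chevalley basis
are nonzero whenever `α + β` is a root. -/
structure ChevalleyNilradical {n : ℕ} {V : Type*} [NormedAddCommGroup V]
    [InnerProductSpace ℝ V] (Φ : RootSystemBase n V)
    (L : Type*) [LieRing L] [LieAlgebra ℂ L] where
  /-- the root vectors `e_α`, `α ∈ R⁺`, a basis of `𝔫` -/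
  e : Module.Basis {β : V // Φ.IsPos β} ℂ L
  /-- the structure constants -/
  N : V → V → ℂ
  lie_eq : ∀ (α β : {β : V // Φ.IsPos β}) (h : Φ.IsPos (α.1 + β.1)),
    ⁅e α, e β⁆ = N α.1 β.1 • e ⟨α.1 + β.1, h⟩
  lie_eq_zero : ∀ α β : {β : V // Φ.IsPos β}, ¬ Φ.IsPos (α.1 + β.1) → ⁅e α, e β⁆ = 0
  N_ne_zero : ∀ α β : {β : V // Φ.IsPos β}, Φ.IsPos (α.1 + β.1) → N α.1 β.1 ≠ 0

namespace ChevalleyNilradical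

variable {n : ℕ} {V : Type*} [NormedAddCommGroup V] [InnerProductSpace ℝ V]
  {Φ : RootSystemBase n V} {L : Type*} [LieRing L] [LieAlgebra ℂ L]
  (C : ChevalleyNilradical Φ L)

/-- The weight-zero cocycle (derivation) `Dᵢ = cᵢ : e_α ↦ Aᵢ(α) e_α`. -/
noncomputable def D (i : Fin n) : Module.End ℂ L :=
  C.e.constr ℂ fun β => (Φ.coord β.1 i : ℂ) • C.e β

/-- The cocycle (derivation) `Bᵢ = bᵢ = e_{γᵢ} ⊗ f^{αᵢ}`, sending `e_{αᵢ} ↦ e_{γᵢ}` where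
`γᵢ = μ − mᵢ αᵢ`, and killing `e_β` for every positive root `β ≠ αᵢ`. -/
noncomputable def B (μ : V) (m : Fin n → ℕ)
    (hγ : ∀ i, Φ.IsPos (μ - m i • Φ.simple i)) (i : Fin n) : Module.End ℂ L :=
  letI := Classical.decEq V
  C.e.constr ℂ fun β => if β.1 = Φ.simple i then C.e ⟨μ - m i • Φ.simple i, hγ i⟩ else 0

end ChevalleyNilradical

namespace RootSystemBase

variable {n : ℕ} {V : Type*} [NormedAddCommGroup V] [InnerProductSpace ℝ V]
variable (Φ : RootSystemBase n V)

lemma coord_eq_of_eq_sum {β : V} (hβ : β ∈ Φ.R) (c : Fin n → ℤ)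
    (h : β = ∑ i, (c i : ℝ) • Φ.simple i) : Φ.coord β = c := by
  funext i
  have hsum : ∑ k, ((Φ.coord β k : ℝ) - c k) • Φ.simple k = 0 := by
    simp only [sub_smul, Finset.sum_sub_distrib, ← Φ.root_eq_sum β hβ, ← h, sub_self]
  have := Fintype.linearIndependent_iff.1 Φ.simple_linearIndependent _ hsum i
  exact_mod_cast sub_eq_zero.1 this

lemma coord_simple (j : Fin n) : Φ.coord (Φ.simple j) = Pi.single j 1 := by
  refine Φ.coord_eq_of_eq_sum (Φ.simple_mem j) _ ?_
  simp [Pi.single_apply, ite_smul]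

lemma isPos_simple (j : Fin n) : Φ.IsPos (Φ.simple j) := by
  refine ⟨Φ.simple_mem j, fun i => ?_⟩
  rw [coord_simple, Pi.single_apply]
  split_ifs <;> simp

lemma coord_add {α β : V} (hα : α ∈ Φ.R) (hβ : β ∈ Φ.R) (h : α + β ∈ Φ.R) :
    Φ.coord (α + β) = Φ.coord α + Φ.coord β := by
  refine Φ.coord_eq_of_eq_sum h _ ?_
  simp only [Pi.add_apply, Int.cast_add, add_smul, Finset.sum_add_distrib,
    ← Φ.root_eq_sum α hα, ← Φ.root_eq_sum β hβ]

lemma coord_sub_nsmul_simple {β : V} (hβ : β ∈ Φ.R) (k : ℕ) (j : Fin n)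
    (h : β - k • Φ.simple j ∈ Φ.R) (i : Fin n) :
    Φ.coord (β - k • Φ.simple j) i = Φ.coord β i - if i = j then (k : ℤ) else 0 := by
  have := Φ.coord_eq_of_eq_sum h (fun i => Φ.coord β i - if i = j then (k : ℤ) else 0) ?_
  · rw [this]
  · simp [sub_smul, Finset.sum_sub_distrib, ← Φ.root_eq_sum β hβ, ite_smul,
      Nat.cast_smul_eq_nsmul]

lemma neg_mem {α : V} (hα : α ∈ Φ.R) : -α ∈ Φ.R := by
  have h0 : α ≠ 0 := fun h => Φ.zero_not_mem (h ▸ hα)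
  have := Φ.reflect_mem α hα α hα
  rw [mul_div_assoc, div_self (inner_self_ne_zero.2 h0), mul_one, two_smul] at this
  simpa using this

lemma coord_neg {α : V} (hα : α ∈ Φ.R) : Φ.coord (-α) = -Φ.coord α := by
  refine Φ.coord_eq_of_eq_sum (Φ.neg_mem hα) _ ?_
  simp only [Pi.neg_apply, Int.cast_neg, neg_smul, Finset.sum_neg_distrib,
    ← Φ.root_eq_sum α hα]

lemma isPos_or_isPos_neg {α : V} (hα : α ∈ Φ.R) : Φ.IsPos α ∨ Φ.IsPos (-α) := by
  refine (Φ.coord_sign α hα).imp (fun h => ⟨hα, h⟩) fun h => ⟨Φ.neg_mem hα, fun i => ?_⟩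
  rw [Φ.coord_neg hα]
  simpa using h i

lemma nsmul_simple_mem {k : ℕ} {j : Fin n} (h : k • Φ.simple j ∈ Φ.R) : k = 1 := by
  rw [← Nat.cast_smul_eq_nsmul ℝ] at h
  rcases Φ.reduced _ (Φ.simple_mem j) _ h with h | h
  · exact_mod_cast h
  · have := Nat.cast_nonneg (α := ℝ) k
    linarith

variable {Φ} in
lemma IsHighest.one_le_coord {μ : V} (hμ : Φ.IsHighest μ) (i : Fin n) :
    1 ≤ Φ.coord μ i := by
  simpa [coord_simple] using hμ.2 _ (Φ.isPos_simple i) i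

/-- In rank two, a root is determined by its two coordinates. -/
lemma root_eq_add {i j : Fin n} (hij : i ≠ j) (huniv : ∀ k, k = i ∨ k = j) {β : V}
    (hβ : β ∈ Φ.R) :
    β = Φ.coord β i • Φ.simple i + Φ.coord β j • Φ.simple j := by
  have hU : (Finset.univ : Finset (Fin n)) = {i, j} := by
    ext k; simpa using huniv k
  conv_lhs => rw [Φ.root_eq_sum β hβ, hU, Finset.sum_pair hij]
  simp only [Int.cast_smul_eq_zsmul]

/-- A root system of rank two whose highest root is the sum of the simple roots has
exactly six roots. -/
lemma card_eq_six {i j : Fin n} (hij : i ≠ j) (huniv : ∀ k, k = i ∨ k = j) {μ : V}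
    (hμ : Φ.IsHighest μ) (hi : Φ.coord μ i = 1) (hj : Φ.coord μ j = 1) :
    Φ.R.card = 6 := by
  classical
  let S : Finset (ℤ × ℤ) := {(1, 0), (0, 1), (1, 1), (-1, 0), (0, -1), (-1, -1)}
  let f : ℤ × ℤ → V := fun p => p.1 • Φ.simple i + p.2 • Φ.simple j
  have hf : Function.Injective f := by
    rintro ⟨a, b⟩ ⟨c, d⟩ h
    have hli : LinearIndependent ℝ ![Φ.simple i, Φ.simple j] := by
      have hinj : Function.Injective ![i, j] := by
        intro x y
        fin_cases x <;> fin_cases y <;> simp [hij, hij.symm]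
      convert Φ.simple_linearIndependent.comp _ hinj using 1
      ext x
      fin_cases x <;> rfl
    have h' : a • Φ.simple i + b • Φ.simple j = c • Φ.simple i + d • Φ.simple j := h
    have hp := LinearIndependent.pair_iff.1 hli (a - c : ℝ) (b - d : ℝ) (by
      simp only [← Int.cast_smul_eq_zsmul ℝ] at h'
      rw [sub_smul, sub_smul, sub_add_sub_comm, h', sub_self])
    have h1 : a = c := by exact_mod_cast sub_eq_zero.1 hp.1
    have h2 : b = d := by exact_mod_cast sub_eq_zero.1 hp.2
    rw [h1, h2]
  have hμf : μ = Φ.simple i + Φ.simple j := by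
    simpa [hi, hj] using Φ.root_eq_add hij huniv hμ.1.1
  have hpos : ∀ β, Φ.IsPos β → (Φ.coord β i, Φ.coord β j) ∈ S ∧
      (-Φ.coord β i, -Φ.coord β j) ∈ S := by
    intro β hβ
    have h1 := hβ.2 i
    have h2 := hβ.2 j
    have h3 := hμ.2 β hβ i
    have h4 := hμ.2 β hβ j
    rw [hi] at h3
    rw [hj] at h4
    have h5 : ¬ (Φ.coord β i = 0 ∧ Φ.coord β j = 0) := by
      rintro ⟨h, h'⟩
      have := Φ.root_eq_add hij huniv hβ.1
      rw [h, h', zero_smul, zero_smul, add_zero] at this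
      exact Φ.zero_not_mem (this ▸ hβ.1)
    generalize Φ.coord β i = a at *
    generalize Φ.coord β j = b at *
    interval_cases a <;> interval_cases b <;> simp_all [S]
  have hR : Φ.R = S.image f := by
    ext β
    rw [Finset.mem_image]
    constructor
    · intro hβ
      refine ⟨(Φ.coord β i, Φ.coord β j), ?_, (Φ.root_eq_add hij huniv hβ).symm⟩
      rcases Φ.isPos_or_isPos_neg hβ with h | h
      · exact (hpos β h).1
      · simpa [Φ.coord_neg hβ] using (hpos _ h).2
    · rintro ⟨p, hp, rfl⟩
      have hi' := Φ.simple_mem i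
      have hj' := Φ.simple_mem j
      have hm' := hμ.1.1
      rw [hμf] at hm'
      have hn := Φ.neg_mem hm'
      simp only [S, Finset.mem_insert, Finset.mem_singleton] at hp
      rcases hp with rfl | rfl | rfl | rfl | rfl | rfl
      · simpa [f] using hi'
      · simpa [f] using hj'
      · simpa [f] using hm'
      · simpa [f] using Φ.neg_mem hi'
      · simpa [f] using Φ.neg_mem hj'
      · simpa [f, add_comm] using hn
  rw [hR, Finset.card_image_of_injective _ hf]
  rfl

end RootSystemBase

namespace ChevalleyNilradical

variable {n : ℕ} {V : Type*} [NormedAddCommGroup V] [InnerProductSpace ℝ V]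
  {Φ : RootSystemBase n V} {L : Type*} [LieRing L] [LieAlgebra ℂ L]
  (C : ChevalleyNilradical Φ L)

lemma D_apply (i : Fin n) (β : {β : V // Φ.IsPos β}) :
    C.D i (C.e β) = (Φ.coord β.1 i : ℂ) • C.e β :=
  C.e.constr_basis ℂ _ β

open Classical in
lemma B_apply (μ : V) (m : Fin n → ℕ) (hγ : ∀ i, Φ.IsPos (μ - m i • Φ.simple i))
    (i : Fin n) (β : {β : V // Φ.IsPos β}) :
    C.B μ m hγ i (C.e β) =
      if β.1 = Φ.simple i then C.e ⟨μ - m i • Φ.simple i, hγ i⟩ else 0 :=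
  C.e.constr_basis ℂ _ β

lemma lie_D_D (i j : Fin n) : ⁅C.D i, C.D j⁆ = 0 := by
  refine C.e.ext fun β => ?_
  simp [LieRing.of_associative_ring_bracket, D_apply, smul_smul, mul_comm]

lemma lie_D_B (μ : V) (m : Fin n → ℕ) (hγ : ∀ i, Φ.IsPos (μ - m i • Φ.simple i))
    (i j : Fin n) :
    ⁅C.D i, C.B μ m hγ j⁆ =
      ((Φ.coord (μ - m j • Φ.simple j) i : ℂ) - if i = j then 1 else 0) •
        C.B μ m hγ j := by
  refine C.e.ext fun β => ?_
  simp only [LieRing.of_associative_ring_bracket, LinearMap.sub_apply, Module.End.mul_apply,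
    LinearMap.smul_apply, D_apply, B_apply, map_smul]
  split_ifs with h hij <;>
    simp_all [D_apply, RootSystemBase.coord_simple, sub_smul]

lemma B_mul_B_eq_zero (μ : V) (m : Fin n → ℕ)
    (hγ : ∀ i, Φ.IsPos (μ - m i • Φ.simple i)) {i j : Fin n}
    (h : μ - m j • Φ.simple j ≠ Φ.simple i) : C.B μ m hγ i * C.B μ m hγ j = 0 := by
  refine C.e.ext fun β => ?_
  rw [Module.End.mul_apply, B_apply]
  split_ifs
  · rw [B_apply, if_neg h, LinearMap.zero_apply]
  · simp

lemma lie_B_B_mem_of_eq {μ : V} (hμ : Φ.IsHighest μ) {m : Fin n → ℕ}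
    (hm : ∀ i, ∀ k : ℕ, k ≤ m i → Φ.IsPos (μ - k • Φ.simple i))
    (hγ : ∀ i, Φ.IsPos (μ - m i • Φ.simple i))
    (hnotA1 : n ≠ 1) (hnotA2 : ¬ (n = 2 ∧ Φ.R.card = 6)) {i j : Fin n}
    (h : μ - m j • Φ.simple j = Φ.simple i) :
    ⁅C.B μ m hγ i, C.B μ m hγ j⁆ ∈ innerDerivations L := by
  have hcoord (k : Fin n) :
      Φ.coord μ k = (if k = i then 1 else 0) + if k = j then (m j : ℤ) else 0 := by
    have := Φ.coord_sub_nsmul_simple hμ.1.1 (m j) j (hγ j).1 k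
    rw [h, Φ.coord_simple, Pi.single_apply] at this
    omega
  have huniv (k : Fin n) : k = i ∨ k = j := by
    by_contra! hk
    have := hμ.one_le_coord k
    simp [hcoord, hk.1, hk.2] at this
  have hU : (Finset.univ : Finset (Fin n)) = {i, j} := by
    ext k; simpa using huniv k
  have hij : i ≠ j := by
    rintro rfl
    apply hnotA1
    simpa using congrArg Finset.card hU
  have hn : n = 2 := by
    simpa [Finset.card_pair hij] using congrArg Finset.card hU
  have hμi : Φ.coord μ i = 1 := by simp [hcoord, hij]
  have hμj : Φ.coord μ j = m j := by simp [hcoord, hij.symm]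
  have hmj1 : 1 ≤ m j := by
    have := hμ.one_le_coord j
    omega
  have hmj : m j ≠ 1 := fun h1 =>
    hnotA2 ⟨hn, Φ.card_eq_six hij huniv hμ hμi (by rw [hμj, h1, Nat.cast_one])⟩
  have hmi : m i = 0 := by
    by_contra h0
    have h1 := hm i 1 (by omega)
    rw [one_smul, ← h, sub_sub_cancel] at h1
    exact hmj (Φ.nsmul_simple_mem h1.1)
  have hν : Φ.IsPos (μ - Φ.simple j) := by simpa using hm j 1 hmj1
  have hadd : μ - Φ.simple j + Φ.simple j = μ := sub_add_cancel _ _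
  have hpos : Φ.IsPos (μ - Φ.simple j + Φ.simple j) := hadd.symm ▸ hμ.1
  have hN := C.N_ne_zero ⟨_, hν⟩ ⟨_, Φ.isPos_simple j⟩ hpos
  have hμne : μ ≠ Φ.simple j := by
    intro h'
    rw [h', Φ.coord_simple, Pi.single_eq_of_ne hij] at hμi
    exact zero_ne_one hμi
  refine ⟨(C.N (μ - Φ.simple j) (Φ.simple j))⁻¹ • C.e ⟨_, hν⟩, C.e.ext fun β => ?_⟩
  have hBj : C.B μ m hγ j (C.B μ m hγ i (C.e β)) = 0 := by
    rw [B_apply]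
    split_ifs
    · rw [B_apply, if_neg]
      simpa [hmi] using hμne
    · simp
  simp only [LieHom.coe_toLinearMap, LieAlgebra.ad_apply, smul_lie,
    LieRing.of_associative_ring_bracket, LinearMap.sub_apply, Module.End.mul_apply, hBj, sub_zero]
  rw [B_apply]
  split_ifs with hβ
  · obtain rfl : β = ⟨_, Φ.isPos_simple j⟩ := Subtype.ext hβ
    rw [B_apply, if_pos h, C.lie_eq _ _ hpos, inv_smul_smul₀ hN]
    congr 2
    simp [hmi]
  · rw [C.lie_eq_zero, smul_zero, map_zero]
    intro hp
    have hc := hμ.2 _ hp i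
    have hνi := Φ.coord_sub_nsmul_simple hμ.1.1 1 j (by simpa using hν.1) i
    rw [one_smul, if_neg hij, sub_zero] at hνi
    rw [Φ.coord_add hν.1 β.2.1 hp.1, Pi.add_apply, hνi] at hc
    have hβi : Φ.coord β.1 i = 0 := le_antisymm (by omega) (β.2.2 i)
    have hβs := Φ.root_eq_add hij huniv β.2.1
    rw [hβi, zero_smul, zero_add] at hβs
    obtain ⟨k, hk⟩ := Int.eq_ofNat_of_zero_le (β.2.2 j)
    rw [hk, natCast_zsmul] at hβs
    have hk1 := Φ.nsmul_simple_mem (hβs ▸ β.2.1)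
    exact hβ (by rw [hβs, hk1, one_smul])

lemma lie_B_B_mem {μ : V} (hμ : Φ.IsHighest μ) {m : Fin n → ℕ}
    (hm : ∀ i, ∀ k : ℕ, k ≤ m i → Φ.IsPos (μ - k • Φ.simple i))
    (hγ : ∀ i, Φ.IsPos (μ - m i • Φ.simple i))
    (hnotA1 : n ≠ 1) (hnotA2 : ¬ (n = 2 ∧ Φ.R.card = 6)) (i j : Fin n) :
    ⁅C.B μ m hγ i, C.B μ m hγ j⁆ ∈ innerDerivations L := by
  by_cases hj : μ - m j • Φ.simple j = Φ.simple i
  · exact C.lie_B_B_mem_of_eq hμ hm hγ hnotA1 hnotA2 hj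
  by_cases hi : μ - m i • Φ.simple i = Φ.simple j
  · rw [← lie_skew]
    exact neg_mem (C.lie_B_B_mem_of_eq hμ hm hγ hnotA1 hnotA2 hi)
  rw [LieRing.of_associative_ring_bracket, C.B_mul_B_eq_zero μ m hγ hj,
    C.B_mul_B_eq_zero μ m hγ hi, sub_zero]
  exact zero_mem _

end ChevalleyNilradical

/-- If `𝔤` is not of type `A₁` or `A₂` (i.e. `𝔤 ≠ 𝔰𝔩(2), 𝔰𝔩(3)`;
equivalently the rank is not `1`, and `𝔤` is not of rank `2` with exactly `6` roots),
then in `Out(𝔫) = Der(𝔫)/ad(𝔫)` the classes of the derivations `Dᵢ`, `Bᵢ` satisfy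
`[Dᵢ, Dⱼ] = 0` and `[Bᵢ, Bⱼ] = 0` for all `i, j`, and `[Dᵢ, Bⱼ] = wᵢ(bⱼ)·Bⱼ`, where
`wᵢ(bⱼ) = Aᵢ(γⱼ) − δᵢⱼ` is the `i`-th coordinate of the weight `γⱼ − αⱼ` of `bⱼ`. -/
theorem bracket_relations_in_Out
    {n : ℕ} {V : Type*} [NormedAddCommGroup V] [InnerProductSpace ℝ V]
    (Φ : RootSystemBase n V) (L : Type*) [LieRing L] [LieAlgebra ℂ L]
    (C : ChevalleyNilradical Φ L) (μ : V) (hμ : Φ.IsHighest μ) (m : Fin n → ℕ)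
    (hm : ∀ i, (∀ k : ℕ, k ≤ m i → Φ.IsPos (μ - k • Φ.simple i)) ∧
      ¬ Φ.IsPos (μ - (m i + 1) • Φ.simple i))
    (hγ : ∀ i, Φ.IsPos (μ - m i • Φ.simple i))
    (hnotA1 : n ≠ 1) (hnotA2 : ¬ (n = 2 ∧ Φ.R.card = 6)) :
    (∀ i j : Fin n, ⁅C.D i, C.D j⁆ ∈ innerDerivations L) ∧
    (∀ i j : Fin n, ⁅C.B μ m hγ i, C.B μ m hγ j⁆ ∈ innerDerivations L) ∧
    (∀ i j : Fin n,
      ⁅C.D i, C.B μ m hγ j⁆ -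
        (((Φ.coord (μ - m j • Φ.simple j) i : ℂ) - if i = j then 1 else 0) •
          C.B μ m hγ j) ∈ innerDerivations L) := by
  refine ⟨fun i j => ?_,
    C.lie_B_B_mem hμ (fun i => (hm i).1) hγ hnotA1 hnotA2, fun i j => ?_⟩
  · rw [C.lie_D_D]
    exact zero_mem _
  · rw [C.lie_D_B, sub_self]
    exact zero_mem _
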